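/- Let d be a connected and cyclically reduced element of the graph group G_F. Then for each integer n ≥ 0, every conjugate of d^{n+2|d|} contains d^n as a segment. -/

import Mathlib

open Pointwise

namespace GraphGroupPaper

/-- The set of commutator relators: `gᵢ` and `gⱼ` commute for every pair of distinct
`i, j` with `{i,j} ∉ F`. -/
def Rels (k : ℕ) (F : Set (Sym2 (Fin k))) : Set (FreeGroup (Fin k)) :=
  {w | ∃ i j : Fin k, i ≠ j ∧ s(i, j) ∉ F ∧
      w = FreeGroup.of i * FreeGroup.of j * (FreeGroup.of i)⁻¹ * (FreeGroup.of j)⁻¹}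

/-- The graph group `G_F` with generators `g₁, …, g_k` and relations `gᵢgⱼ = gⱼgᵢ`
for all distinct `i, j` with `{i,j} ∉ F`. -/
abbrev Grp (k : ℕ) (F : Set (Sym2 (Fin k))) := PresentedGroup (Rels k F)

/-- The generator `gᵢ` of the graph group. -/
def gen (k : ℕ) (F : Set (Sym2 (Fin k))) (i : Fin k) : Grp k F :=
  PresentedGroup.of i

/-- The group element corresponding to a symbol: `(i, true)` stands for `gᵢ`,
`(i, false)` stands for `gᵢ⁻¹`. -/
def sym (k : ℕ) (F : Set (Sym2 (Fin k))) (α : Fin k × Bool) : Grp k F :=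
  if α.2 then gen k F α.1 else (gen k F α.1)⁻¹

/-- The product of the word `l` of symbols, as an element of the graph group. -/
def wordProd (k : ℕ) (F : Set (Sym2 (Fin k))) (l : List (Fin k × Bool)) : Grp k F :=
  (l.map (sym k F)).prod

/-- `|x|` : the length of a shortest word in the symbols representing `x`. -/
noncomputable def len {k : ℕ} {F : Set (Sym2 (Fin k))} (x : Grp k F) : ℕ :=
  sInf {n | ∃ l : List (Fin k × Bool), wordProd k F l = x ∧ l.length = n}

/-- The partial order on `G_F`:  `x ≤ y` iff `|y| = |x| + |x⁻¹y|`. -/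
def le {k : ℕ} {F : Set (Sym2 (Fin k))} (x y : Grp k F) : Prop :=
  len y = len x + len (x⁻¹ * y)

/-- `m` is the meet `x ∧ y` (greatest lower bound w.r.t. `le`). -/
def IsMeet {k : ℕ} {F : Set (Sym2 (Fin k))} (x y m : Grp k F) : Prop :=
  le m x ∧ le m y ∧ ∀ w, le w x → le w y → le w m

/-- `j` is the (finite) join `x ∨ y` (least upper bound w.r.t. `le`);
`x ∨ y` is finite iff such a `j` exists. -/
def IsJoin {k : ℕ} {F : Set (Sym2 (Fin k))} (x y j : Grp k F) : Prop :=
  le x j ∧ le y j ∧ ∀ w, le x w → le y w → le j w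

/-- `j` is the (finite) join of the set `S`. -/
def IsJoinSet {k : ℕ} {F : Set (Sym2 (Fin k))} (S : Set (Grp k F)) (j : Grp k F) : Prop :=
  (∀ s ∈ S, le s j) ∧ ∀ w, (∀ s ∈ S, le s w) → le j w

/-- `y` is a segment of `a` if `a = x·y·z` for some `x, z`. -/
def Segment {k : ℕ} {F : Set (Sym2 (Fin k))} (y a : Grp k F) : Prop :=
  ∃ x z, a = x * y * z ∧ len a = len x + len y + len z

/-- The left-invariant metric `dist(x,y) = |x⁻¹y|`. -/
noncomputable def dist {k : ℕ} {F : Set (Sym2 (Fin k))} (x y : Grp k F) : ℕ :=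
  len (x⁻¹ * y)

/-- A nonempty set `L` is convex if `x, z ∈ L` and `dist(x,y) + dist(y,z) = dist(x,z)`
imply `y ∈ L`. -/
def ConvexSet {k : ℕ} {F : Set (Sym2 (Fin k))} (L : Set (Grp k F)) : Prop :=
  L.Nonempty ∧ ∀ x z y : Grp k F, x ∈ L → z ∈ L →
    dist x y + dist y z = dist x z → y ∈ L

/-- An ideal: nonempty, downward closed, and closed under finite joins. -/
def IdealSet {k : ℕ} {F : Set (Sym2 (Fin k))} (I : Set (Grp k F)) : Prop :=
  I.Nonempty ∧ (∀ x ∈ I, ∀ y, le y x → y ∈ I) ∧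
    (∀ x ∈ I, ∀ y ∈ I, ∀ j, IsJoin x y j → j ∈ I)

/-- `H` is closed if both `H` and `H⁻¹` are ideals. -/
def ClosedSet {k : ℕ} {F : Set (Sym2 (Fin k))} (H : Set (Grp k F)) : Prop :=
  IdealSet H ∧ IdealSet H⁻¹

/-- `m` is a minimal element of `S` w.r.t. `le`. -/
def MinimalIn {k : ℕ} {F : Set (Sym2 (Fin k))} (S : Set (Grp k F)) (m : Grp k F) : Prop :=
  m ∈ S ∧ ∀ x ∈ S, le x m → x = m

/-- `l` is a reduced (i.e. shortest) word representing `x`. -/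
def MinWord {k : ℕ} {F : Set (Sym2 (Fin k))} (x : Grp k F) (l : List (Fin k × Bool)) : Prop :=
  wordProd k F l = x ∧ l.length = len x

open Classical in
/-- `#_α(x)`: the number of occurrences of the symbol `α` (not counting `α⁻¹`)
in a reduced word representing `x`. -/
noncomputable def symCount {k : ℕ} {F : Set (Sym2 (Fin k))} (α : Fin k × Bool)
    (x : Grp k F) : ℕ :=
  if h : ∃ l, MinWord x l then h.choose.count α else 0

/-- The symbol `α` occurs in `x`. -/
def Occurs {k : ℕ} {F : Set (Sym2 (Fin k))} (α : Fin k × Bool) (x : Grp k F) : Prop :=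
  0 < symCount α x

/-- `α` is a maximal symbol of `x`, i.e. `xα⁻¹ ≤ x`. -/
def MaxSym {k : ℕ} {F : Set (Sym2 (Fin k))} (α : Fin k × Bool) (x : Grp k F) : Prop :=
  le (x * (sym k F α)⁻¹) x

/-- A peak: an element with precisely one maximal symbol. -/
def IsPeak {k : ℕ} {F : Set (Sym2 (Fin k))} (p : Grp k F) : Prop :=
  ∃! α : Fin k × Bool, MaxSym α p

/-- An `α`-peak: a peak whose unique maximal symbol is `α`. -/
def AlphaPeak {k : ℕ} {F : Set (Sym2 (Fin k))} (α : Fin k × Bool) (p : Grp k F) : Prop :=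
  MaxSym α p ∧ ∀ β, MaxSym β p → β = α

/-- The set of generator indices occurring in `b`. -/
def Support {k : ℕ} {F : Set (Sym2 (Fin k))} (b : Grp k F) : Set (Fin k) :=
  {i | Occurs (i, true) b ∨ Occurs (i, false) b}

/-- `b` is connected: the generators occurring in `b` induce a connected subgraph of
the graph `([k], F)`. -/
def Conn {k : ℕ} {F : Set (Sym2 (Fin k))} (b : Grp k F) : Prop :=
  (SimpleGraph.induce (Support b) (SimpleGraph.fromEdgeSet F)).Connected

/-- `b` is cyclically reduced: `b ∧ b⁻¹ = 1`. -/
def CycRed {k : ℕ} {F : Set (Sym2 (Fin k))} (b : Grp k F) : Prop :=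
  IsMeet b b⁻¹ 1

/-- The subgroup generated by the generators other than `gᵢ` that commute with `gᵢ`. -/
def link {k : ℕ} (F : Set (Sym2 (Fin k))) (i : Fin k) : Subgroup (Grp k F) :=
  Subgroup.closure {g | ∃ j, j ≠ i ∧ s(i, j) ∉ F ∧ g = gen k F j}

/-- A wall (hyperplane) of the Cayley graph: the parallelism class of an edge labelled `gᵢ`,
encoded by the coset of `link F i` formed by the initial vertices of its edges. -/
abbrev Wall (k : ℕ) (F : Set (Sym2 (Fin k))) := Σ i : Fin k, Grp k F ⧸ link F i

section Walls

variable {k : ℕ} {F : Set (Sym2 (Fin k))}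

/-- The wall crossed by the edge from `1` to `gᵢ`. -/
def baseWall (F : Set (Sym2 (Fin k))) (i : Fin k) : Wall k F :=
  ⟨i, ((1 : Grp k F) : Grp k F ⧸ link F i)⟩

/-- The wall crossed by the edge from `g` to `g * α`. -/
def edgeWall (g : Grp k F) (α : Fin k × Bool) : Wall k F :=
  (if α.2 then g else g * (gen k F α.1)⁻¹) • baseWall F α.1

lemma gen_mem_link {i j : Fin k} (hij : j ≠ i) (h : s(i, j) ∉ F) : gen k F j ∈ link F i :=
  Subgroup.subset_closure ⟨j, hij, h, rfl⟩

lemma smul_baseWall_eq_iff (g h : Grp k F) (i : Fin k) :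
    g • baseWall F i = h • baseWall F i ↔ g⁻¹ * h ∈ link F i := by
  simp only [baseWall, Sigma.smul_mk, Sigma.mk.injEq, heq_eq_eq, true_and]
  rw [← QuotientGroup.eq]
  simp

lemma gen_commute {i j : Fin k} (hij : j ≠ i) (h : s(i, j) ∉ F) :
    Commute (gen k F i) (gen k F j) := by
  have h1 : PresentedGroup.mk (Rels k F) (FreeGroup.of i * FreeGroup.of j *
      (FreeGroup.of i)⁻¹ * (FreeGroup.of j)⁻¹) = 1 :=
    PresentedGroup.one_of_mem ⟨i, j, hij.symm, h, rfl⟩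
  simp only [map_mul, map_inv] at h1
  rw [mul_inv_eq_one, mul_inv_eq_iff_eq_mul] at h1
  exact h1

lemma commute_of_mem_link {i : Fin k} {g : Grp k F} (hg : g ∈ link F i) :
    Commute (gen k F i) g := by
  induction hg using Subgroup.closure_induction with
  | mem x hx => obtain ⟨j, h1, h2, rfl⟩ := hx; exact gen_commute h1 h2
  | one => exact Commute.one_right _
  | mul x y _ _ hx hy => exact hx.mul_right hy
  | inv x _ hx => exact hx.inv_right

open Classical in
/-- The affine action of `gᵢ` on `ZMod 2`-valued functions on walls. -/
noncomputable def genPerm (F : Set (Sym2 (Fin k))) (i : Fin k) :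
    Equiv.Perm (Wall k F → ZMod 2) where
  toFun f K := (if K = baseWall F i then 1 else 0) + f ((gen k F i)⁻¹ • K)
  invFun f K := f (gen k F i • K) - if gen k F i • K = baseWall F i then 1 else 0
  left_inv f := by ext K; simp
  right_inv f := by ext K; simp

lemma smul_baseWall_of_mem {i : Fin k} {g : Grp k F} (hg : g ∈ link F i) :
    g • baseWall F i = baseWall F i := by
  simpa using (smul_baseWall_eq_iff g 1 i).2 (by simpa using hg)

lemma genPerm_mul_comm {i j : Fin k} (hij : i ≠ j) (h : s(i, j) ∉ F) :
    genPerm F i * genPerm F j = genPerm F j * genPerm F i := by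
  have hi : (gen k F i)⁻¹ ∈ link F j := inv_mem (gen_mem_link hij (by rwa [Sym2.eq_swap]))
  have hj : (gen k F j)⁻¹ ∈ link F i := inv_mem (gen_mem_link hij.symm h)
  have hc := (gen_commute (F := F) hij.symm h).inv_inv.eq
  ext f K
  have e1 : (gen k F i)⁻¹ • K = baseWall F j ↔ K = baseWall F j := by
    conv_lhs => rw [← smul_baseWall_of_mem hi]
    exact smul_left_cancel_iff _
  have e2 : (gen k F j)⁻¹ • K = baseWall F i ↔ K = baseWall F i := by
    conv_lhs => rw [← smul_baseWall_of_mem hj]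
    exact smul_left_cancel_iff _
  simp only [Equiv.Perm.mul_apply, genPerm, Equiv.coe_fn_mk, smul_smul, hc]
  classical
  rw [if_congr e1 rfl rfl, if_congr e2 rfl rfl]
  ring

/-- The affine action of the group on `ZMod 2`-valued functions on walls. -/
noncomputable def wallAction (k : ℕ) (F : Set (Sym2 (Fin k))) :
    Grp k F →* Equiv.Perm (Wall k F → ZMod 2) :=
  PresentedGroup.toGroup (f := genPerm F) (by
    rintro _ ⟨i, j, hij, h, rfl⟩
    simp only [map_mul, map_inv, FreeGroup.lift_apply_of]
    rw [genPerm_mul_comm hij h]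
    group)

/-- The side of the wall `K` on which `g` lies; it is `0` for `g = 1`. -/
noncomputable def side (g : Grp k F) (K : Wall k F) : ZMod 2 := wallAction k F g 0 K

lemma wallAction_gen (i : Fin k) : wallAction k F (gen k F i) = genPerm F i :=
  PresentedGroup.toGroup.of _

lemma wallAction_apply (g : Grp k F) :
    ∀ f K, wallAction k F g f K = side g K + f (g⁻¹ • K) := by
  have hg : g ∈ Subgroup.closure (Set.range (PresentedGroup.of (rels := Rels k F))) := by
    simp
  induction hg using Subgroup.closure_induction with
  | mem x hx =>
    obtain ⟨i, rfl⟩ := hx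
    intro f K
    have := wallAction_gen (F := F) i
    simp only [gen] at this
    simp [side, this, genPerm, gen]
  | one => simp [side]
  | mul x y _ _ hx hy =>
    intro f K
    simp only [side, map_mul, Equiv.Perm.mul_apply] at hx hy ⊢
    rw [hx, hy, hx (wallAction k F y 0)]
    simp [mul_smul, add_assoc]
  | inv x _ hx =>
    have key : ∀ f K, wallAction k F x⁻¹ f K = f (x • K) - side x (x • K) := by
      intro f K
      have := hx (wallAction k F x⁻¹ f) (x • K)
      rw [← Equiv.Perm.mul_apply, ← map_mul] at this
      rw [mul_inv_cancel, map_one, inv_smul_smul, Equiv.Perm.one_apply] at this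
      rw [this]; ring
    intro f K
    have h0 : side x⁻¹ K = 0 - side x (x • K) := key 0 K
    rw [key, h0, inv_inv]
    ring

@[simp] lemma side_one (K : Wall k F) : side (1 : Grp k F) K = 0 := by simp [side]

lemma side_mul (g h : Grp k F) (K : Wall k F) : side (g * h) K = side g K + side h (g⁻¹ • K) := by
  rw [← wallAction_apply, side, map_mul, Equiv.Perm.mul_apply]; rfl

open Classical in
lemma side_gen (i : Fin k) (K : Wall k F) :
    side (gen k F i) K = if K = baseWall F i then 1 else 0 := by
  simp [side, wallAction_gen, genPerm]

lemma side_mul_left_eq_iff (g x y : Grp k F) (K : Wall k F) :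
    side (g * x) K = side (g * y) K ↔ side x (g⁻¹ • K) = side y (g⁻¹ • K) := by
  rw [side_mul, side_mul, add_right_inj]

lemma side_smul_eq_iff (g x y : Grp k F) (K : Wall k F) :
    side (g * x) (g • K) = side (g * y) (g • K) ↔ side x K = side y K := by
  simp [side_mul_left_eq_iff]

open Classical in
lemma side_mul_sym (g : Grp k F) (α : Fin k × Bool) (K : Wall k F) :
    side (g * sym k F α) K = side g K + if K = edgeWall g α then 1 else 0 := by
  obtain ⟨i, b⟩ := α
  cases b
  · have h := side_mul (g * (gen k F i)⁻¹) (gen k F i) K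
    rw [inv_mul_cancel_right, side_gen] at h
    simp only [sym, edgeWall, Bool.false_eq_true, if_false, h, inv_smul_eq_iff, add_assoc]
    rw [CharTwo.add_self_eq_zero, add_zero]
  · simp only [sym, edgeWall, if_true, side_mul, side_gen, inv_smul_eq_iff]

lemma side_mul_sym_eq_iff (g : Grp k F) (α : Fin k × Bool) (K : Wall k F) :
    side (g * sym k F α) K = side g K ↔ K ≠ edgeWall g α := by
  rw [side_mul_sym]; split_ifs with h <;> simp [h]

lemma edgeWall_mul (g h : Grp k F) (α : Fin k × Bool) :
    edgeWall (g * h) α = g • edgeWall h α := by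
  simp only [edgeWall]; split_ifs <;> simp [smul_smul, mul_assoc]

@[simp] lemma edgeWall_fst (g : Grp k F) (α : Fin k × Bool) : (edgeWall g α).1 = α.1 := rfl

/-- Two generator indices are parallel to no common square: they agree or span an edge of `F`. -/
def Clash (F : Set (Sym2 (Fin k))) (i j : Fin k) : Prop := i = j ∨ s(i, j) ∈ F

lemma not_clash {i j : Fin k} : ¬ Clash F i j ↔ j ≠ i ∧ s(i, j) ∉ F := by
  simp [Clash, eq_comm]

lemma side_of_mem_link {i : Fin k} {g : Grp k F} (hg : g ∈ link F i) :
    ∀ K : Wall k F, Clash F i K.1 → side g K = 0 := by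
  induction hg using Subgroup.closure_induction with
  | mem x hx =>
    obtain ⟨j, h1, h2, rfl⟩ := hx
    intro K hK
    rw [side_gen, if_neg]
    rintro rfl
    exact not_clash.2 ⟨h1, h2⟩ hK
  | one => simp
  | mul x y _ _ hx hy => intro K hK; rw [side_mul, hx K hK, hy (x⁻¹ • K) hK, add_zero]
  | inv x _ hx =>
    intro K hK
    have := side_mul x x⁻¹ (x • K)
    rw [mul_inv_cancel, side_one, hx (x • K) hK, inv_smul_smul, zero_add] at this
    exact this.symm

@[simp] lemma wordProd_nil : wordProd k F [] = 1 := rfl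

@[simp] lemma wordProd_cons (α : Fin k × Bool) (l : List (Fin k × Bool)) :
    wordProd k F (α :: l) = sym k F α * wordProd k F l := by simp [wordProd]

@[simp] lemma wordProd_append (l l' : List (Fin k × Bool)) :
    wordProd k F (l ++ l') = wordProd k F l * wordProd k F l' := by simp [wordProd]

lemma exists_wordProd_eq (x : Grp k F) : ∃ l, wordProd k F l = x := by
  obtain ⟨y, rfl⟩ := PresentedGroup.mk_surjective _ x
  have hmk : FreeGroup.lift (gen k F) = PresentedGroup.mk (Rels k F) :=
    FreeGroup.ext_hom _ _ fun i => by simp [gen, PresentedGroup.of]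
  refine ⟨y.toWord, ?_⟩
  rw [← hmk, ← FreeGroup.mk_toWord (x := y), FreeGroup.lift_mk, FreeGroup.mk_toWord, wordProd]
  congr 2
  ext α
  cases h : α.2 <;> simp [sym, h]

lemma exists_minWord (x : Grp k F) : ∃ l, MinWord x l := by
  obtain ⟨l, hl⟩ := exists_wordProd_eq x
  exact Nat.sInf_mem (s := {n | ∃ l, wordProd k F l = x ∧ l.length = n}) ⟨_, l, hl, rfl⟩

lemma len_wordProd_le (l : List (Fin k × Bool)) : len (wordProd k F l) ≤ l.length :=
  Nat.sInf_le ⟨l, rfl, rfl⟩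

lemma len_mul_le (x y : Grp k F) : len (x * y) ≤ len x + len y := by
  obtain ⟨l, rfl, hl⟩ := exists_minWord x
  obtain ⟨l', rfl, hl'⟩ := exists_minWord y
  rw [← hl, ← hl', ← wordProd_append, ← List.length_append]
  exact len_wordProd_le _

lemma len_of_append_left {l l' : List (Fin k × Bool)}
    (h : len (wordProd k F (l ++ l')) = (l ++ l').length) : len (wordProd k F l) = l.length := by
  have h1 := len_mul_le (wordProd k F l) (wordProd k F l')
  have h2 := len_wordProd_le (F := F) l
  have h3 := len_wordProd_le (F := F) l'
  rw [wordProd_append, List.length_append] at h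
  omega

/-- A path on which the side of a wall changes has an edge crossing that wall. -/
lemma exists_crossing (l : List (Fin k × Bool)) (g : Grp k F) (K : Wall k F)
    (h : side (g * wordProd k F l) K ≠ side g K) :
    ∃ u α v, l = u ++ α :: v ∧ edgeWall (g * wordProd k F u) α = K := by
  induction l generalizing g with
  | nil => simp at h
  | cons α l ih =>
    by_cases hK : K = edgeWall g α
    · exact ⟨[], α, l, rfl, by simp [hK]⟩
    · rw [← Ne, ← side_mul_sym_eq_iff] at hK
      rw [← hK, wordProd_cons, ← mul_assoc] at h
      obtain ⟨u, β, v, rfl, hu⟩ := ih _ h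
      exact ⟨α :: u, β, v, rfl, by simpa [mul_assoc] using hu⟩

lemma edgeWall_recross {g w : Grp k F} {α β : Fin k × Bool}
    (h : edgeWall g α = edgeWall (g * sym k F α * w) β) :
    side (g * sym k F α * w) (edgeWall g α) ≠ side (g * sym k F α) (edgeWall g α) ∨
      w ∈ link F α.1 ∧ sym k F α * sym k F β = 1 := by
  have hfst : α.1 = β.1 := congrArg Sigma.fst h
  have h1 := (side_mul_sym_eq_iff (g * sym k F α * w) β (edgeWall g α)).not.2 (by simpa using h)
  have h2 := (side_mul_sym_eq_iff g α (edgeWall g α)).not.2 (by simp)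
  have hK := h
  obtain ⟨i, a⟩ := α
  obtain ⟨j, b⟩ := β
  obtain rfl : i = j := hfst
  cases a <;> cases b <;>
    simp only [edgeWall, sym, Bool.false_eq_true, if_false, if_true, smul_baseWall_eq_iff] at hK
  · have hm : w * (gen k F i)⁻¹ ∈ link F i := by
      convert hK using 1
      group
    have h3 := side_mul (g * (gen k F i)⁻¹) (w * (gen k F i)⁻¹) (edgeWall g (i, false))
    rw [side_of_mem_link hm _ (Or.inl rfl), add_zero, ← mul_assoc] at h3
    simp only [sym, Bool.false_eq_true, if_false] at h1 ⊢
    exact Or.inl fun h4 => h1 (h3.trans h4.symm)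
  · refine Or.inr ⟨?_, by simp [sym]⟩
    convert hK using 1
    group
  · refine Or.inr ⟨?_, by simp [sym]⟩
    have hm : gen k F i * w * (gen k F i)⁻¹ ∈ link F i := by
      convert hK using 1
      group
    have hc := (commute_of_mem_link hm).eq
    rw [inv_mul_cancel_right] at hc
    rwa [mul_left_cancel hc] at hm
  · have hm : gen k F i * w ∈ link F i := by
      convert hK using 1
      group
    have h3 := side_mul g (gen k F i * w) (edgeWall g (i, true))
    rw [side_of_mem_link hm _ (Or.inl rfl), add_zero, ← mul_assoc] at h3
    simp only [sym, if_true] at h2 ⊢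
    exact Or.inl fun h4 => h2 (h4.symm.trans h3)

lemma sym_commute {α : Fin k × Bool} {w : Grp k F} (hw : w ∈ link F α.1) :
    Commute (sym k F α) w := by
  have h := commute_of_mem_link hw
  unfold sym
  split_ifs
  · exact h
  · exact h.inv_left

/-- A shortest word does not cross the same wall twice. -/
lemma edgeWall_ne_of_reduced (u : List (Fin k × Bool)) (α : Fin k × Bool)
    (v : List (Fin k × Bool)) (β : Fin k × Bool) (t : List (Fin k × Bool))
    (h : len (wordProd k F (u ++ α :: (v ++ β :: t))) = (u ++ α :: (v ++ β :: t)).length) :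
    edgeWall (wordProd k F u) α ≠ edgeWall (wordProd k F (u ++ α :: v)) β := by
  induction hn : v.length using Nat.strong_induction_on generalizing v β t with
  | _ n ih =>
  intro hK
  rcases edgeWall_recross (w := wordProd k F v) (by simpa [mul_assoc] using hK) with hne | ⟨hm, hc⟩
  · obtain ⟨v₁, γ, v₂, rfl, hv⟩ := exists_crossing _ _ _ hne
    refine ih v₁.length ?_ v₁ γ (v₂ ++ β :: t) (by simpa using h) rfl ?_
    · simp [← hn]
    · simp only [← hv, wordProd_append, wordProd_cons, mul_assoc]
  · have he : sym k F α * (wordProd k F v * sym k F β) = wordProd k F v := by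
      rw [← mul_assoc, (sym_commute hm).eq, mul_assoc, hc, mul_one]
    have h1 := len_wordProd_le (F := F) (u ++ (v ++ t))
    have h2 : wordProd k F (u ++ (v ++ t)) = wordProd k F (u ++ α :: (v ++ β :: t)) := by
      simp only [wordProd_append, wordProd_cons]
      nth_rw 1 [← he]
      simp only [mul_assoc]
    rw [h2, h] at h1
    simp at h1

lemma side_edgeWall_of_reduced {u : List (Fin k × Bool)} {α : Fin k × Bool}
    {v : List (Fin k × Bool)}
    (h : len (wordProd k F (u ++ α :: v)) = (u ++ α :: v).length) :
    side (wordProd k F u) (edgeWall (wordProd k F u) α) = 0 := by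
  by_contra hne
  have hne' : side (1 * wordProd k F u) (edgeWall (wordProd k F u) α) ≠
      side 1 (edgeWall (wordProd k F u) α) := by simpa using hne
  obtain ⟨u₁, β, u₂, rfl, hu⟩ := exists_crossing _ _ _ hne'
  refine edgeWall_ne_of_reduced u₁ β u₂ α v (by simpa using h) ?_
  simpa using hu

/-- No wall separates `y` both from `x` and from `z`. -/
def Between (x y z : Grp k F) : Prop := ∀ K : Wall k F, side x K = side y K ∨ side y K = side z K

lemma Between.mul_left {x y z : Grp k F} (h : Between x y z) (g : Grp k F) :
    Between (g * x) (g * y) (g * z) := fun K => by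
  simpa only [side_mul_left_eq_iff] using h (g⁻¹ • K)

lemma between_of_reduced {u v : List (Fin k × Bool)}
    (h : len (wordProd k F (u ++ v)) = (u ++ v).length) :
    Between 1 (wordProd k F u) (wordProd k F (u ++ v)) := by
  intro K
  by_contra! hK
  obtain ⟨h1, h2⟩ := hK
  rw [wordProd_append] at h2
  obtain ⟨v₁, α, v₂, rfl, hv⟩ := exists_crossing _ _ _ h2.symm
  have h1' : side (1 * wordProd k F u) K ≠ side 1 K := by simpa using h1.symm
  obtain ⟨u₁, β, u₂, rfl, hu⟩ := exists_crossing _ _ _ h1'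
  refine edgeWall_ne_of_reduced u₁ β (u₂ ++ v₁) α v₂ (by simpa using h) ?_
  rw [one_mul] at hu
  rw [hu, ← hv]
  simp [mul_assoc]

/-- The walls separating `x` and `y`. -/
def separators (x y : Grp k F) : Set (Wall k F) := {K | side x K ≠ side y K}

lemma smul_mem_separators (g x y : Grp k F) (K : Wall k F) :
    g • K ∈ separators (g * x) (g * y) ↔ K ∈ separators x y :=
  (side_smul_eq_iff g x y K).not

lemma separators_mul_sym (g : Grp k F) (α : Fin k × Bool) :
    separators g (g * sym k F α) = {edgeWall g α} := by
  ext K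
  simp only [separators, Set.mem_ofPred_eq, Set.mem_singleton_iff]
  rw [← not_iff_not, ← Ne, ← side_mul_sym_eq_iff, not_not, eq_comm]

lemma separators_comm (x y : Grp k F) : separators x y = separators y x := by
  ext K; exact ne_comm

lemma Between.separators_eq {x y z : Grp k F} (h : Between x y z) :
    separators x z = separators x y ∪ separators y z := by
  ext K
  have := h K
  simp only [separators, Set.mem_union, Set.mem_ofPred_eq]
  grind

lemma Between.disjoint {x y z : Grp k F} (h : Between x y z) :
    Disjoint (separators x y) (separators y z) := by
  rw [Set.disjoint_left]
  intro K h1 h2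
  exact (h K).elim h1 h2

lemma finite_separators_and_ncard_eq_of_reduced (l : List (Fin k × Bool))
    (h : len (wordProd k F l) = l.length) :
    (separators 1 (wordProd k F l)).Finite ∧
      (separators 1 (wordProd k F l)).ncard = l.length := by
  induction l using List.reverseRecOn with
  | nil => simp [separators]
  | append_singleton l α ih =>
    obtain ⟨hf, hc⟩ := ih (len_of_append_left h)
    have hb := between_of_reduced h
    have hs : separators (wordProd k F l) (wordProd k F (l ++ [α])) =
        {edgeWall (wordProd k F l) α} := by simpa using separators_mul_sym _ α
    have hd := hb.disjoint
    rw [hb.separators_eq, Set.ncard_union_eq hd hf (hs ▸ Set.finite_singleton _), hc, hs]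
    simp [hf]

lemma finite_separators (x y : Grp k F) : (separators x y).Finite := by
  obtain ⟨l, hl, hl'⟩ := exists_minWord (x⁻¹ * y)
  have h := (finite_separators_and_ncard_eq_of_reduced l (by rw [hl, hl'])).1
  rw [hl] at h
  refine (h.image (x • ·)).subset fun K hK => ⟨x⁻¹ • K, ?_, by simp⟩
  rw [← smul_mem_separators x⁻¹, inv_mul_cancel] at hK
  exact hK

/-- The word metric counts separating walls. -/
lemma len_inv_mul (x y : Grp k F) : len (x⁻¹ * y) = (separators x y).ncard := by
  obtain ⟨l, hl, hl'⟩ := exists_minWord (x⁻¹ * y)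
  have h := (finite_separators_and_ncard_eq_of_reduced l (by rw [hl, hl'])).2
  rw [hl, hl'] at h
  rw [← h, ← Set.ncard_image_of_injective _ (MulAction.injective x)]
  congr 1
  ext K
  constructor
  · rintro ⟨K, hK, rfl⟩
    rw [← smul_mem_separators x] at hK
    simpa using hK
  · intro hK
    refine ⟨x⁻¹ • K, ?_, by simp⟩
    rw [← smul_mem_separators x⁻¹, inv_mul_cancel] at hK
    exact hK

lemma len_eq_ncard (x : Grp k F) : len x = (separators 1 x).ncard := by
  simpa using len_inv_mul 1 x

lemma between_iff (x y z : Grp k F) :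
    Between x y z ↔ len (x⁻¹ * z) = len (x⁻¹ * y) + len (y⁻¹ * z) := by
  simp only [len_inv_mul]
  constructor
  · intro h
    rw [h.separators_eq, Set.ncard_union_eq h.disjoint (finite_separators _ _)
      (finite_separators _ _)]
  · intro h
    have hsub : separators x z ⊆ separators x y ∪ separators y z := by
      intro K hK
      simp only [separators, Set.mem_union, Set.mem_ofPred_eq] at hK ⊢
      grind
    have h1 := Set.ncard_union_add_ncard_inter (separators x y) (separators y z)
      (finite_separators _ _) (finite_separators _ _)
    have h2 := Set.ncard_le_ncard hsub ((finite_separators _ _).union (finite_separators _ _))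
    have h3 : (separators x y ∩ separators y z).ncard = 0 := by omega
    rw [Set.ncard_eq_zero ((finite_separators _ _).inter_of_left _)] at h3
    intro K
    by_contra! hK
    have : K ∈ separators x y ∩ separators y z := hK
    rw [h3] at this
    exact this

/-- A wall separating `x` from `z` is crossed by an edge of a geodesic from `x` to `z`. -/
lemma exists_edge_between {x z : Grp k F} {K : Wall k F} (hK : K ∈ separators x z) :
    ∃ g α, edgeWall g α = K ∧ Between x g z ∧ side x K = side g K := by
  obtain ⟨l, hl, hl'⟩ := exists_minWord (x⁻¹ * z)
  have hz : z = x * wordProd k F l := by rw [hl]; group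
  have hK' : side (x * wordProd k F l) K ≠ side x K := by rw [← hz]; exact hK.symm
  obtain ⟨u, α, v, rfl, hu⟩ := exists_crossing _ _ _ hK'
  rw [← hl] at hl'
  refine ⟨x * wordProd k F u, α, hu, ?_, ?_⟩
  · simpa [hz] using (between_of_reduced hl'.symm).mul_left x
  · rw [← hu, edgeWall_mul, side_mul, inv_smul_smul, side_edgeWall_of_reduced hl'.symm, add_zero]

lemma eq_of_ne_of_ne {a b c : ZMod 2} (h : a ≠ b) (h' : b ≠ c) : a = c := by
  revert a b c; decide

lemma Clash.symm {i j : Fin k} (h : Clash F i j) : Clash F j i := by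
  rwa [Clash, eq_comm, Sym2.eq_swap]

lemma exists_base (g : Grp k F) (α : Fin k × Bool) :
    ∃ b, edgeWall g α = b • baseWall F α.1 ∧ ∀ H ≠ edgeWall g α, side b H = side g H := by
  refine ⟨_, rfl, fun H hH => ?_⟩
  have h := (side_mul_sym_eq_iff g α H).2 hH
  unfold sym at h
  split_ifs at h ⊢
  · rfl
  · exact h

/-- Edges crossing the same wall `K` lie on the same side of any other wall that does not
commute with `K`. -/
lemma side_eq_of_edgeWall_eq {g g' : Grp k F} {α α' : Fin k × Bool} {H : Wall k F}
    (h : edgeWall g α = edgeWall g' α') (hH : H ≠ edgeWall g α) (hc : Clash F α.1 H.1) :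
    side g H = side g' H := by
  obtain ⟨b, hb, hbs⟩ := exists_base g α
  obtain ⟨b', hb', hbs'⟩ := exists_base g' α'
  have hfst : α.1 = α'.1 := congrArg Sigma.fst h
  rw [← hbs H hH, ← hbs' H (h ▸ hH)]
  rw [hb, hb', ← hfst, smul_baseWall_eq_iff] at h
  have := side_mul b (b⁻¹ * b') H
  rw [mul_inv_cancel_left, side_of_mem_link h (b⁻¹ • H) hc, add_zero] at this
  exact this.symm

/-- Two walls cutting the group into four nonempty pieces have distinct commuting labels. -/
lemma not_clash_of_crossing {x₁ x₂ x₃ x₄ : Grp k F} {H K : Wall k F}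
    (h₁₂ : side x₁ H = side x₂ H) (h₃₄ : side x₃ H = side x₄ H) (h₁₃ : side x₁ H ≠ side x₃ H)
    (k₁₂ : side x₁ K ≠ side x₂ K) (k₃₄ : side x₃ K ≠ side x₄ K) : ¬ Clash F H.1 K.1 := by
  intro hc
  obtain ⟨g, α, hg, hb, -⟩ := exists_edge_between k₁₂
  obtain ⟨g', α', hg', hb', -⟩ := exists_edge_between k₃₄
  have e : side x₁ H = side g H := (hb H).elim id fun h => h₁₂.trans h.symm
  have e' : side x₃ H = side g' H := (hb' H).elim id fun h => h₃₄.trans h.symm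
  refine h₁₃ ?_
  rw [e, e']
  refine side_eq_of_edgeWall_eq (hg.trans hg'.symm) ?_ ?_
  · rintro rfl
    rw [hg] at h₁₂
    exact k₁₂ h₁₂
  · have : α.1 = K.1 := by rw [← hg, edgeWall_fst]
    rw [this]
    exact hc.symm

lemma edgeWall_mem_separators_of_reduced {u : List (Fin k × Bool)} {α : Fin k × Bool}
    {v : List (Fin k × Bool)}
    (h : len (wordProd k F (u ++ α :: v)) = (u ++ α :: v).length) :
    edgeWall (wordProd k F u) α ∈ separators 1 (wordProd k F (u ++ α :: v)) := by
  have h0 := side_edgeWall_of_reduced h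
  have h1 := (side_mul_sym_eq_iff (wordProd k F u) α (edgeWall (wordProd k F u) α)).not.2 (by simp)
  have hb := between_of_reduced (u := u ++ [α]) (v := v) (F := F) (by simpa using h)
    (edgeWall (wordProd k F u) α)
  simp only [separators, Set.mem_ofPred_eq]
  rw [h0] at h1
  simp only [wordProd_append, wordProd_cons, wordProd_nil, mul_one, List.append_assoc,
    side_one, List.cons_append, List.nil_append] at hb ⊢
  grind

lemma mem_link_of_separators {i : Fin k} {g : Grp k F}
    (h : ∀ K ∈ separators 1 g, ¬ Clash F i K.1) : g ∈ link F i := by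
  obtain ⟨l, rfl, hl⟩ := exists_minWord g
  refine Subgroup.list_prod_mem _ fun x hx => ?_
  obtain ⟨α, hα, rfl⟩ := List.mem_map.1 hx
  obtain ⟨u, v, rfl⟩ := List.append_of_mem hα
  have h1 := not_clash.1 (h _ (edgeWall_mem_separators_of_reduced hl.symm))
  have h2 : gen k F α.1 ∈ link F i := gen_mem_link h1.1 h1.2
  unfold sym
  split_ifs
  · exact h2
  · exact inv_mem h2

lemma not_clash_of_mem_link {i : Fin k} {g : Grp k F} (hg : g ∈ link F i) {K : Wall k F}
    (hK : K ∈ separators 1 g) : ¬ Clash F i K.1 := fun hc =>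
  hK (by rw [side_one, side_of_mem_link hg K hc])

@[simp] lemma len_one : len (1 : Grp k F) = 0 := by simp [len_eq_ncard, separators]

lemma len_inv (x : Grp k F) : len x⁻¹ = len x := by
  rw [← mul_one x⁻¹, len_inv_mul, separators_comm, ← len_eq_ncard]

@[simp] lemma len_sym (α : Fin k × Bool) : len (sym k F α) = 1 := by
  have h := separators_mul_sym (F := F) 1 α
  rw [one_mul] at h
  rw [len_eq_ncard, h, Set.ncard_singleton]

lemma between_one_iff (x y : Grp k F) : Between 1 x (x * y) ↔ len (x * y) = len x + len y := by
  simp [between_iff]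

/-- If a product is not reduced, then some symbol ending the first factor cancels against the
second factor. -/
lemma exists_cancel (g h : Grp k F) (hlt : len (g * h) < len g + len h) :
    ∃ α, len (g * (sym k F α)⁻¹) < len g ∧ len (sym k F α * h) < len h := by
  induction hn : len g + len h using Nat.strong_induction_on generalizing g h with
  | _ n ih =>
  obtain ⟨l, rfl, hl⟩ := exists_minWord g
  obtain ⟨m, rfl, hm⟩ := exists_minWord h
  rcases l with _ | ⟨γ, l⟩
  · simp at hlt
  rcases m.eq_nil_or_concat with rfl | ⟨m, β, rfl⟩
  · simp at hlt
  have hl1 := len_wordProd_le (F := F) l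
  have hm1 := len_wordProd_le (F := F) m
  simp only [wordProd_cons, wordProd_append, wordProd_nil, mul_one, List.length_cons,
    List.concat_eq_append, List.length_append, List.length_nil, zero_add] at hl hm hlt ⊢ hn
  set g' := wordProd k F l
  set h' := wordProd k F m
  have a1 := len_mul_le (sym k F γ) g'
  have a2 := len_mul_le h' (sym k F β)
  have a3 := len_mul_le g' (h' * sym k F β)
  have a4 := len_mul_le (sym k F γ * g') h'
  rw [len_sym] at a1 a2
  by_cases c1 : len (g' * (h' * sym k F β)) < len g' + len (h' * sym k F β)
  · obtain ⟨α, e1, e2⟩ := ih _ (by omega) g' _ c1 rfl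
    refine ⟨α, ?_, e2⟩
    have := len_mul_le (sym k F γ) (g' * (sym k F α)⁻¹)
    rw [len_sym] at this
    rw [mul_assoc]
    omega
  by_cases c2 : len (sym k F γ * g' * h') < len (sym k F γ * g') + len h'
  · obtain ⟨α, e1, e2⟩ := ih _ (by omega) _ h' c2 rfl
    refine ⟨α, e1, ?_⟩
    have := len_mul_le (sym k F α * h') (sym k F β)
    rw [len_sym] at this
    rw [← mul_assoc]
    omega
  have q1 := len_mul_le (sym k F γ) (g' * h')
  have q2 := len_mul_le g' h'
  have q3 := len_mul_le (g' * h') (sym k F β)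
  have e1 : len (sym k F γ * (g' * h')) = len (sym k F γ * g' * h') := by rw [mul_assoc]
  have e2 : len (g' * h' * sym k F β) = len (g' * (h' * sym k F β)) := by rw [mul_assoc]
  have e3 : sym k F γ * (g' * h') * sym k F β = sym k F γ * g' * (h' * sym k F β) := by
    simp only [mul_assoc]
  rw [len_sym] at q1 q3
  have b1 : Between 1 (g' * h') (g' * h' * sym k F β) := by
    rw [between_one_iff, len_sym]
    omega
  have b2 : Between 1 (sym k F γ) (sym k F γ * (g' * h')) := by
    rw [between_one_iff, len_sym]
    omega
  have b3 : Between 1 g' (g' * h') := by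
    rw [between_one_iff]
    omega
  have b4 : ¬ Between 1 (sym k F γ * (g' * h')) (sym k F γ * (g' * h') * sym k F β) := by
    rw [between_one_iff, len_sym, e3]
    omega
  have hb1 := b1.mul_left (sym k F γ)
  rw [mul_one, ← mul_assoc] at hb1
  have hK : edgeWall 1 γ = edgeWall (sym k F γ * (g' * h')) β := by
    simp only [Between, not_forall, not_or] at b4
    obtain ⟨K, k1, k2⟩ := b4
    rw [eq_comm, side_mul_sym_eq_iff, not_not] at k2
    subst k2
    have := (hb1 (edgeWall (sym k F γ * (g' * h')) β))
    have h2 := (side_mul_sym_eq_iff (sym k F γ * (g' * h')) β _).not.2 (not_not.2 rfl)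
    have h3 := separators_mul_sym (F := F) 1 γ
    rw [one_mul] at h3
    have h4 : edgeWall (sym k F γ * (g' * h')) β ∈ separators 1 (sym k F γ) := by
      simp only [separators, Set.mem_ofPred_eq]
      grind
    rw [h3] at h4
    exact h4.symm
  obtain ⟨hw, hγβ⟩ : g' * h' ∈ link F γ.1 ∧ sym k F γ * sym k F β = 1 := by
    refine (edgeWall_recross (g := 1) (by simpa using hK)).resolve_left ?_
    rw [one_mul, not_not]
    refine ((b2 _).resolve_left ?_).symm
    rw [eq_comm]
    simpa using (side_mul_sym_eq_iff 1 γ (edgeWall 1 γ)).not.2 (by simp)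
  have hg' : g' ∈ link F γ.1 := mem_link_of_separators fun K hK =>
    not_clash_of_mem_link hw (by rw [b3.separators_eq]; exact Or.inl hK)
  have hh' : h' ∈ link F γ.1 := by simpa using mul_mem (inv_mem hg') hw
  refine ⟨γ, ?_, ?_⟩
  · have e : sym k F γ * g' * (sym k F γ)⁻¹ = g' := by
      rw [(sym_commute hg').eq, mul_inv_cancel_right]
    rw [e]
    omega
  · have e : sym k F γ * (h' * sym k F β) = h' := by
      rw [← mul_assoc, (sym_commute hh').eq, mul_assoc, hγβ, mul_one]
    rw [e]
    omega

lemma len_sym_mul_lt_iff (α : Fin k × Bool) (h : Grp k F) :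
    len (sym k F α * h) < len h ↔ edgeWall (sym k F α)⁻¹ α ∈ separators 1 h := by
  have hs := separators_mul_sym (F := F) (sym k F α)⁻¹ α
  rw [inv_mul_cancel] at hs
  have hmem : ∀ K, K ∈ separators 1 (sym k F α)⁻¹ ↔ K = edgeWall (sym k F α)⁻¹ α := fun K => by
    rw [separators_comm, hs]; rfl
  have e1 := len_inv_mul (sym k F α)⁻¹ h
  have e2 := len_inv_mul 1 h
  rw [inv_inv] at e1
  constructor
  · intro hlt
    by_contra hK
    have hb : Between (sym k F α)⁻¹ 1 h := fun K => by
      by_contra! hne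
      exact hK ((hmem K).1 hne.1.symm ▸ hne.2)
    rw [between_iff] at hb
    simp only [inv_inv, mul_one, inv_one, one_mul] at hb
    omega
  · intro hK
    have hb : Between 1 (sym k F α)⁻¹ h := fun K => by
      by_contra! hne
      have := (hmem K).1 hne.1
      subst this
      simp only [separators, Set.mem_ofPred_eq] at hK
      exact hK (eq_of_ne_of_ne hne.1 hne.2)
    rw [between_iff] at hb
    simp only [inv_inv, inv_one, one_mul, len_inv, len_sym] at hb
    omega

lemma CycRed.not_cancel {d : Grp k F} (hcr : CycRed d) (α : Fin k × Bool)
    (h1 : len (d * (sym k F α)⁻¹) < len d) : ¬ len (sym k F α * d) < len d := by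
  intro h2
  have e1 := len_mul_le (sym k F α)⁻¹ (sym k F α * d)
  have e2 := len_mul_le (d * (sym k F α)⁻¹) (sym k F α)
  have e3 : len (sym k F α * d⁻¹) = len (d * (sym k F α)⁻¹) := by
    rw [← len_inv, mul_inv_rev, inv_inv]
  rw [inv_mul_cancel_left, len_inv, len_sym] at e1
  rw [inv_mul_cancel_right, len_sym] at e2
  have h3 := hcr.2.2 (sym k F α)⁻¹ (by rw [le, inv_inv, len_inv, len_sym]; omega)
    (by rw [le, inv_inv, len_inv, len_inv, len_sym]; omega)
  rw [le, len_one, len_inv, len_sym] at h3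
  omega

lemma CycRed.between_pow {d : Grp k F} (hcr : CycRed d) (m : ℕ) : Between 1 d (d ^ (m + 1)) := by
  induction m with
  | zero => intro K; simp
  | succ m ih =>
    rw [pow_succ', between_one_iff]
    refine le_antisymm (len_mul_le _ _) (not_lt.1 fun hlt => ?_)
    obtain ⟨α, h1, h2⟩ := exists_cancel _ _ hlt
    have h3 := hcr.not_cancel α h1
    rw [len_sym_mul_lt_iff] at h2 h3
    set a := (sym k F α)⁻¹
    have ha := separators_mul_sym a α
    have ha1 : a * sym k F α = 1 := inv_mul_cancel _
    rw [ha1] at ha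
    set K := edgeWall a α
    have hd := congrArg (d • ·) ha
    have hK : d • K ∈ separators 1 d := by
      by_contra hne
      have hb : Between 1 d (d * a) := fun H => by
        by_contra! hH
        have : H ∈ separators (d * 1) (d * a) := by rw [mul_one]; exact hH.2
        rw [← smul_inv_smul d H, smul_mem_separators, separators_comm, ha,
          Set.mem_singleton_iff, inv_smul_eq_iff] at this
        subst this
        exact hne hH.1
      rw [between_one_iff] at hb
      omega
    have h0 : side 1 K = side d K := not_not.1 h3
    have h4 : side a K ≠ side 1 K := by
      have : K ∈ separators a 1 := by rw [ha]; rfl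
      exact this
    have h5 : side a (d • K) = side 1 (d • K) := by
      by_contra hne
      have : d • K ∈ separators a 1 := hne
      rw [ha] at this
      rw [this] at hK
      exact hK h0
    have h6 : side d (d • K) = side (d ^ (m + 1)) (d • K) := (ih (d • K)).resolve_left hK
    refine not_clash_of_crossing (x₁ := 1) (x₂ := d) (x₃ := a) (x₄ := d ^ (m + 1))
      (H := K) (K := d • K) h0 ?_ h4.symm hK ?_ (Or.inl rfl)
    · exact eq_of_ne_of_ne h4 h2
    · rw [h5, ← h6]
      exact hK

/-- All powers of `d` lie on a geodesic, in order. -/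
def Axial (d : Grp k F) : Prop := ∀ m : ℕ, Between 1 d (d ^ (m + 1))

lemma Axial.side_of_lt {d : Grp k F} (hd : Axial d) {s t : ℤ} (hst : s < t) {K : Wall k F}
    (hK : K ∈ separators (d ^ s) (d ^ (s + 1))) : side (d ^ t) K = side (d ^ (s + 1)) K := by
  obtain ⟨m, rfl⟩ : ∃ m : ℕ, t = s + (m + 1) := ⟨(t - s - 1).toNat, by omega⟩
  have h := (hd m).mul_left (d ^ s) K
  have e : d ^ (s + (m + 1) : ℤ) = d ^ s * d ^ (m + 1) := by
    rw [zpow_add]; norm_cast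
  rw [mul_one, ← zpow_add_one, ← e] at h
  exact (h.resolve_left hK).symm

lemma Axial.side_of_le {d : Grp k F} (hd : Axial d) {s t : ℤ} (hts : t ≤ s) {K : Wall k F}
    (hK : K ∈ separators (d ^ s) (d ^ (s + 1))) : side (d ^ t) K = side (d ^ s) K := by
  induction t, hts using Int.leInductionDown with
  | base => rfl
  | pred t ht ih =>
    by_contra hne
    have hK' : K ∈ separators (d ^ (t - 1)) (d ^ (t - 1 + 1)) := by
      rw [← ih] at hne
      rwa [sub_add_cancel]
    have h1 := hd.side_of_lt (s := t - 1) (t := s) (by omega) hK'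
    have h2 := hd.side_of_lt (s := t - 1) (t := s + 1) (by omega) hK'
    exact hK (h1.trans h2.symm)

lemma zpow_smul_mem_separators (d : Grp k F) (j : ℤ) (H : Wall k F) :
    d ^ j • H ∈ separators (d ^ j) (d ^ (j + 1)) ↔ H ∈ separators 1 d := by
  rw [zpow_add_one, ← smul_mem_separators (d ^ j) 1 d, mul_one]

/-- `x` lies beyond the `j`-th translate of the wall `H` along the axis of `d`. -/
def Beyond (d x : Grp k F) (H : Wall k F) (j : ℤ) : Prop :=
  side x (d ^ j • H) ≠ side (d ^ j) (d ^ j • H)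

lemma side_eq_iff_beyond (d x y : Grp k F) (H : Wall k F) (j : ℤ) :
    side x (d ^ j • H) = side y (d ^ j • H) ↔ (Beyond d x H j ↔ Beyond d y H j) := by
  unfold Beyond
  generalize side x (d ^ j • H) = a
  generalize side y (d ^ j • H) = b
  generalize side (d ^ j) (d ^ j • H) = c
  revert a b c
  decide

lemma beyond_zpow_mul (d x : Grp k F) (H : Wall k F) (N j : ℤ) :
    Beyond d (d ^ N * x) H j ↔ Beyond d x H (j - N) := by
  unfold Beyond
  have e : d ^ j = d ^ N * d ^ (j - N) := by rw [← zpow_add, add_sub_cancel]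
  rw [e, mul_smul, Ne, Ne, side_smul_eq_iff]

lemma Axial.beyond_zpow {d : Grp k F} (hd : Axial d) {H : Wall k F} (hH : H ∈ separators 1 d)
    (t j : ℤ) : Beyond d (d ^ t) H j ↔ j < t := by
  have hK := (zpow_smul_mem_separators d j H).2 hH
  constructor
  · intro h
    by_contra! hle
    exact h (hd.side_of_le hle hK)
  · intro hlt h
    exact hK (h.symm.trans (hd.side_of_lt hlt hK))

lemma Axial.beyond_of_clash {d : Grp k F} (hd : Axial d) {H H' : Wall k F}
    (hH : H ∈ separators 1 d) (hH' : H' ∈ separators 1 d) (hc : Clash F H.1 H'.1)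
    {x : Grp k F} {j : ℤ} (h : Beyond d x H' (j + 1)) : Beyond d x H j := by
  by_contra hx
  refine not_clash_of_crossing (x₁ := d ^ j) (x₂ := x) (x₃ := d ^ (j + 1)) (x₄ := d ^ (j + 2))
    (H := d ^ j • H) (K := d ^ (j + 1) • H') ?_ ?_ ?_ ?_ ?_ hc
  all_goals simp only [Ne, side_eq_iff_beyond, hd.beyond_zpow hH, hd.beyond_zpow hH', h, hx]
  all_goals simp

lemma mem_support_iff (d : Grp k F) (i : Fin k) :
    i ∈ Support d ↔ ∃ H ∈ separators 1 d, H.1 = i := by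
  have hex := exists_minWord d
  have hs : ∀ α, Occurs α d ↔ α ∈ hex.choose := fun α => by
    unfold Occurs symCount
    rw [dif_pos hex]
    exact List.count_pos_iff
  obtain ⟨hl, hl'⟩ := hex.choose_spec
  simp only [Support, Set.mem_ofPred_eq, hs]
  generalize hex.choose = l at hl hl'
  subst hl
  constructor
  · intro h
    obtain ⟨b, hb⟩ : ∃ b, (i, b) ∈ l := h.elim (⟨_, ·⟩) (⟨_, ·⟩)
    obtain ⟨u, v, rfl⟩ := List.append_of_mem hb
    exact ⟨_, edgeWall_mem_separators_of_reduced hl'.symm, rfl⟩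
  · rintro ⟨H, hH, rfl⟩
    have hH' : side (1 * wordProd k F l) H ≠ side 1 H := by rw [one_mul]; exact Ne.symm hH
    obtain ⟨u, ⟨i, b⟩, v, rfl, rfl⟩ := exists_crossing _ _ _ hH'
    cases b <;> simp

lemma Axial.beyond_of_beyond {d : Grp k F} (hd : Axial d) (hconn : Conn d) {H H' : Wall k F}
    (hH : H ∈ separators 1 d) (hH' : H' ∈ separators 1 d)
    {x : Grp k F} {j t : ℤ} (ht : j + len d ≤ t) (h : Beyond d x H' t) : Beyond d x H j := by
  have mono : ∀ s : ℤ, j + len d ≤ s → Beyond d x H' s → Beyond d x H' (j + len d) := by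
    intro s hs
    induction s, hs using Int.leInduction with
    | base => exact id
    | succ s hs ih => exact fun hb => ih (hd.beyond_of_clash hH' hH' (Or.inl rfl) hb)
  have along : ∀ (a b : Support d)
      (w : (SimpleGraph.induce (Support d) (SimpleGraph.fromEdgeSet F)).Walk a b),
      ∀ (H₁ : Wall k F), H₁ ∈ separators 1 d → H₁.1 = a → H'.1 = b →
        ∀ (r : ℕ), w.length + 1 ≤ r → ∀ j : ℤ, Beyond d x H' (j + r) → Beyond d x H₁ j := by
    intro a b w
    induction w with
    | nil =>
      intro H₁ hH₁ e e' r hr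
      induction r, hr using Nat.le_induction with
      | base =>
        intro j hb
        exact hd.beyond_of_clash hH₁ hH' (Or.inl (e.trans e'.symm)) (by simpa using hb)
      | succ r hr ih =>
        intro j hb
        refine ih j (hd.beyond_of_clash hH' hH' (Or.inl rfl) ?_)
        simpa [add_assoc] using hb
    | @cons a c b hadj w ih =>
      intro H₁ hH₁ e e' r hr j hb
      obtain ⟨H₂, hH₂, e₂⟩ := (mem_support_iff d c).1 c.2
      simp only [SimpleGraph.Walk.length_cons] at hr
      obtain ⟨r, rfl⟩ : ∃ r', r = r' + 1 := ⟨r - 1, by omega⟩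
      refine hd.beyond_of_clash hH₁ hH₂ (Or.inr ?_)
        (ih H₂ hH₂ e₂ e' r (by omega) (j + 1) ?_)
      · rw [e, e₂]
        simp only [SimpleGraph.comap_adj, SimpleGraph.fromEdgeSet_adj] at hadj
        exact hadj.1
      · convert hb using 1
        push_cast
        ring
  obtain ⟨w⟩ := hconn.preconnected ⟨H.1, (mem_support_iff d _).2 ⟨H, hH, rfl⟩⟩
    ⟨H'.1, (mem_support_iff d _).2 ⟨H', hH', rfl⟩⟩
  classical
  refine along _ _ w.toPath.1 H hH rfl rfl (len d) ?_ j (mono t ht h)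
  have := Fintype.ofFinite (Support d)
  have hlt := w.toPath.2.length_lt
  have hsub : Support d ⊆ Sigma.fst '' separators 1 d := fun i hi => by
    obtain ⟨K, hK, rfl⟩ := (mem_support_iff d i).1 hi
    exact ⟨K, hK, rfl⟩
  have h1 := Set.ncard_le_ncard hsub ((finite_separators 1 d).image _)
  have h2 := Set.ncard_image_le (f := Sigma.fst) (finite_separators 1 d)
  rw [← Nat.card_eq_fintype_card, Nat.card_coe_set_eq] at hlt
  rw [len_eq_ncard]
  omega

lemma Axial.zpow_smul_injective {d : Grp k F} (hd : Axial d) {H : Wall k F}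
    (hH : H ∈ separators 1 d) : Function.Injective fun j : ℤ => d ^ j • H := by
  intro s t hst
  wlog hlt : s < t generalizing s t
  · rcases lt_trichotomy s t with h | h | h
    · exact this hst h
    · exact h
    · exact (this hst.symm h).symm
  have h := hd.side_of_le (s := t) (t := s) hlt.le ((zpow_smul_mem_separators d t H).2 hH)
  have h' := hd.side_of_le (s := t) (t := s + 1) hlt ((zpow_smul_mem_separators d t H).2 hH)
  have hs := (zpow_smul_mem_separators d s H).2 hH
  simp only at hst
  rw [hst] at hs
  exact absurd (h.trans h'.symm) hs

lemma Axial.exists_not_beyond {d : Grp k F} (hd : Axial d) {H : Wall k F}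
    (hH : H ∈ separators 1 d) (x : Grp k F) : ∃ j : ℤ, ¬ Beyond d x H j := by
  by_contra! hb
  have hinj : Function.Injective fun n : ℕ => d ^ (n : ℤ) • H := fun a b hab => by
    exact_mod_cast hd.zpow_smul_injective hH hab
  refine Set.infinite_of_injective_forall_mem hinj (s := separators 1 x) (fun n => ?_)
    (finite_separators 1 x)
  have h0 := hd.beyond_zpow hH 0 n
  rw [zpow_zero] at h0
  simp only [separators, Set.mem_ofPred_eq, Ne, side_eq_iff_beyond, h0, hb n]
  simp

lemma Axial.exists_beyond {d : Grp k F} (hd : Axial d) {H : Wall k F}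
    (hH : H ∈ separators 1 d) (x : Grp k F) : ∃ j : ℤ, Beyond d x H j := by
  by_contra! hb
  have hinj : Function.Injective fun n : ℕ => d ^ (-(n : ℤ) - 1) • H := fun a b hab => by
    have := hd.zpow_smul_injective hH hab
    omega
  refine Set.infinite_of_injective_forall_mem hinj (s := separators 1 x) (fun n => ?_)
    (finite_separators 1 x)
  have h0 := hd.beyond_zpow hH 0 (-(n : ℤ) - 1)
  rw [zpow_zero] at h0
  simp only [separators, Set.mem_ofPred_eq, Ne, side_eq_iff_beyond, h0, hb (-(n : ℤ) - 1)]
  simp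
  omega

lemma Conn.separators_nonempty {d : Grp k F} (hconn : Conn d) : (separators 1 d).Nonempty := by
  obtain ⟨a⟩ := hconn.nonempty
  obtain ⟨H, hH, -⟩ := (mem_support_iff d _).1 a.2
  exact ⟨H, hH⟩

lemma Conn.len_pos {d : Grp k F} (hconn : Conn d) : 0 < len d := by
  rw [len_eq_ncard, Set.ncard_pos (finite_separators 1 d)]
  exact hconn.separators_nonempty

/-- The position of `x` along the axis of `d`, up to an error of `|d|`. -/
lemma Axial.exists_position {d : Grp k F} (hd : Axial d) (hconn : Conn d) (x : Grp k F) :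
    ∃ i : ℤ, ∀ H ∈ separators 1 d, ∀ j : ℤ,
      (Beyond d x H j → j < i) ∧ (j + len d < i → Beyond d x H j) := by
  obtain ⟨H₀, hH₀⟩ := hconn.separators_nonempty
  obtain ⟨j₀, hj₀⟩ := hd.exists_not_beyond hH₀ x
  obtain ⟨j₁, hj₁⟩ := hd.exists_beyond hH₀ x
  obtain ⟨m, ⟨H, hH, hm⟩, hmax⟩ := Int.exists_greatest_of_bdd
    (P := fun j => ∃ H ∈ separators 1 d, Beyond d x H j)
    ⟨j₀ + len d, fun j ⟨H, hH, hj⟩ => not_lt.1 fun hlt =>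
      hj₀ (hd.beyond_of_beyond hconn hH₀ hH hlt.le hj)⟩ ⟨j₁, H₀, hH₀, hj₁⟩
  refine ⟨m + 1, fun H' hH' j => ⟨fun hj => ?_, fun hj => ?_⟩⟩
  · exact Int.lt_add_one_of_le (hmax j ⟨H', hH', hj⟩)
  · exact hd.beyond_of_beyond hconn hH' hH (by omega) hm

lemma eq_zpow_smul_or_forall_side_eq (d : Grp k F) (K : Wall k F) :
    (∃ H ∈ separators 1 d, ∃ j : ℤ, K = d ^ j • H) ∨ ∀ j : ℤ, side (d ^ j) K = side 1 K := by
  by_cases h : ∃ j : ℤ, K ∈ separators (d ^ j) (d ^ (j + 1))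
  · obtain ⟨j, hj⟩ := h
    refine Or.inl ⟨d ^ (-j) • K, ?_, j, ?_⟩
    · rw [← zpow_smul_mem_separators d j, zpow_neg, smul_inv_smul]
      exact hj
    · rw [zpow_neg, smul_inv_smul]
  · simp only [separators, Set.mem_ofPred_eq, not_exists, not_not] at h
    refine Or.inr fun j => ?_
    induction j using Int.induction_on with
    | zero => rw [zpow_zero]
    | succ j ih => rw [← h, ih]
    | pred j ih => rw [h, sub_add_cancel, ih]

/-- The wall `K` separates both `x` and `y` from the axis of `d`. -/
def Deviates (d x y : Grp k F) (K : Wall k F) : Prop :=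
  (∀ j : ℤ, side (d ^ j) K = side 1 K) ∧ side x K ≠ side 1 K ∧ side y K ≠ side 1 K

lemma Axial.segment_of_forall_not_deviates {d : Grp k F} (hd : Axial d) (hconn : Conn d) (n : ℕ)
    (x : Grp k F) (h : ∀ K, ¬ Deviates d x (d ^ (n + 2 * len d) * x) K) :
    Segment (d ^ n) (x⁻¹ * d ^ (n + 2 * len d) * x) := by
  obtain ⟨i, hi⟩ := hd.exists_position hconn x
  set N := n + 2 * len d with hN
  have hpow : d ^ N * x = d ^ (N : ℤ) * x := by rw [zpow_natCast]
  have key : ∀ K, (side x K = side (d ^ i) K ∨ side (d ^ i) K = side (d ^ (i + n)) K) ∧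
      (side x K = side (d ^ (i + n)) K ∨ side (d ^ (i + n)) K = side (d ^ N * x) K) := by
    intro K
    obtain ⟨H, hH, j, rfl⟩ | hK := eq_zpow_smul_or_forall_side_eq d K
    · rw [hpow]
      simp only [side_eq_iff_beyond, hd.beyond_zpow hH, beyond_zpow_mul]
      have h1 := hi H hH j
      have h2 := hi H hH (j - N)
      by_cases c1 : j < i
      · have := h2.2 (by omega)
        exact ⟨Or.inr (by omega), Or.inr (iff_of_true (by omega) this)⟩
      · have h3 : ¬ Beyond d x H j := fun hb => c1 (h1.1 hb)
        refine ⟨Or.inl (iff_of_false h3 c1), ?_⟩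
        by_cases c2 : j < i + n
        · exact Or.inr (iff_of_true c2 (h2.2 (by omega)))
        · exact Or.inl (iff_of_false h3 c2)
    · refine ⟨Or.inr (by rw [hK, hK]), ?_⟩
      rw [hK]
      by_contra! hne
      exact h K ⟨hK, hne.1, hne.2.symm⟩
  have b1 : Between x (d ^ i) (d ^ (i + n)) := fun K => (key K).1
  have b2 : Between x (d ^ (i + n)) (d ^ N * x) := fun K => (key K).2
  rw [between_iff] at b1 b2
  have e : (d ^ i)⁻¹ * d ^ (i + n) = d ^ n := by
    rw [zpow_add, inv_mul_cancel_left, zpow_natCast]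
  rw [e] at b1
  refine ⟨x⁻¹ * d ^ i, (d ^ (i + n))⁻¹ * (d ^ N * x), ?_, ?_⟩
  · rw [← e]
    group
  · rw [mul_assoc]
    omega

lemma Axial.not_clash_of_deviates {d : Grp k F} (hd : Axial d) (hconn : Conn d) {n : ℕ}
    {x : Grp k F} {K H : Wall k F} (hK : Deviates d x (d ^ (n + 2 * len d) * x) K)
    (hH : H ∈ separators 1 d) : ¬ Clash F H.1 K.1 := by
  obtain ⟨i, hi⟩ := hd.exists_position hconn x
  have hpos := hconn.len_pos
  have hpow : d ^ (n + 2 * len d) * x = d ^ (n + 2 * len d : ℤ) * x := by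
    rw [← zpow_natCast]
    push_cast
    rfl
  have h1 : ¬ Beyond d x H i := fun hb => lt_irrefl _ ((hi H hH i).1 hb)
  have h2 : Beyond d x H (i - (n + 2 * len d)) := (hi H hH _).2 (by omega)
  refine not_clash_of_crossing (x₁ := x) (x₂ := d ^ i) (x₃ := d ^ (n + 2 * len d) * x)
    (x₄ := d ^ (i + 1)) (H := d ^ i • H) (K := K) ?_ ?_ ?_ ?_ ?_
  · simp [side_eq_iff_beyond, hd.beyond_zpow hH, h1]
  · rw [hpow]
    simp [side_eq_iff_beyond, hd.beyond_zpow hH, beyond_zpow_mul, h2]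
  · rw [hpow]
    simp [side_eq_iff_beyond, beyond_zpow_mul, h1, h2]
  · rw [hK.1]
    exact hK.2.1
  · rw [hK.1]
    exact hK.2.2

lemma smul_edgeWall_one_of_mem {α : Fin k × Bool} {g : Grp k F} (hg : g ∈ link F α.1) :
    g • edgeWall (1 : Grp k F) α = edgeWall 1 α := by
  unfold edgeWall
  split_ifs
  · rw [one_smul, smul_baseWall_of_mem hg]
  · rw [one_mul, smul_smul, ← (commute_of_mem_link hg).inv_left.eq, mul_smul,
      smul_baseWall_of_mem hg]

/-- If some wall separates both `x` and `d ^ N * x` from the axis of `d`, then `x` starts with a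
symbol commuting with `d`. -/
lemma Axial.exists_sym_of_deviates {d : Grp k F} (hd : Axial d) (hconn : Conn d) {n : ℕ}
    {x : Grp k F} {K₀ : Wall k F} (hK₀ : Deviates d x (d ^ (n + 2 * len d) * x) K₀) :
    ∃ α, Commute (sym k F α) d ∧ len ((sym k F α)⁻¹ * x) < len x := by
  set y := d ^ (n + 2 * len d) * x with hy
  have hex : ∃ r g α, Deviates d x y (edgeWall g α) ∧ Between 1 g x ∧
      side 1 (edgeWall g α) = side g (edgeWall g α) ∧ len g = r := by
    obtain ⟨g, α, rfl, hb, hs⟩ := exists_edge_between (Ne.symm hK₀.2.1 : K₀ ∈ separators 1 x)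
    exact ⟨_, g, α, hK₀, hb, hs, rfl⟩
  classical
  obtain ⟨g, α, hK, hb, hs, hr⟩ := Nat.find_spec hex
  have hmin : ∀ g' α', Deviates d x y (edgeWall g' α') → Between 1 g' x →
      side 1 (edgeWall g' α') = side g' (edgeWall g' α') → len g ≤ len g' :=
    fun g' α' h1 h2 h3 => hr ▸ Nat.find_min' hex ⟨g', α', h1, h2, h3, rfl⟩
  set K := edgeWall g α with hKdef
  have hnc : ∀ H ∈ separators 1 d, ¬ Clash F α.1 H.1 := fun H hH hc =>
    hd.not_clash_of_deviates hconn hK hH hc.symm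
  have hg : g ∈ link F α.1 := by
    refine mem_link_of_separators fun K' hK' hc => ?_
    have hK'x : K' ∈ separators 1 x := by rw [hb.separators_eq]; exact Or.inl hK'
    obtain ⟨H, hH, j, rfl⟩ | hK'1 := eq_zpow_smul_or_forall_side_eq d K'
    · exact hnc H hH hc
    have hdev : ¬ Deviates d x y K' := by
      obtain ⟨g', β, rfl, hb', hs'⟩ := exists_edge_between hK'
      intro hdev
      have hle := hmin g' β hdev (fun L => ?_) hs'
      · rw [between_iff] at hb'
        simp only [inv_one, one_mul] at hb'
        have h0 : separators g' g = ∅ := by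
          rw [← Set.ncard_eq_zero (finite_separators g' g), ← len_inv_mul]
          omega
        have h1 : edgeWall g' β ∈ separators g' g := by
          intro h
          exact hK' (hs'.trans h)
        simp [h0] at h1
      · have h1 := hb' L
        have h2 := hb L
        grind
    have hyK' : side y K' = side 1 K' := by
      by_contra hne
      exact hdev ⟨hK'1, Ne.symm hK'x, hne⟩
    refine not_clash_of_crossing (x₁ := 1) (x₂ := y) (x₃ := g) (x₄ := x) (H := K') (K := K)
      hyK'.symm (eq_of_ne_of_ne (Ne.symm hK') hK'x) hK' hK.2.2.symm ?_ hc.symm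
    rw [← hs]
    exact hK.2.1.symm
  have hdl : d ∈ link F α.1 := mem_link_of_separators hnc
  refine ⟨α, sym_commute hdl, ?_⟩
  have hK1 : K = edgeWall 1 α := by
    rw [← smul_edgeWall_one_of_mem hg, ← edgeWall_mul, mul_one]
  have hs1 := separators_mul_sym (F := F) 1 α
  rw [one_mul, ← hK1] at hs1
  have hbx : Between 1 (sym k F α) x := fun L => by
    by_contra! hne
    have hL : L ∈ separators 1 (sym k F α) := hne.1
    rw [hs1, Set.mem_singleton_iff] at hL
    subst hL
    exact hK.2.1 (eq_of_ne_of_ne hne.1 hne.2).symm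
  rw [between_iff] at hbx
  simp only [inv_one, one_mul, len_sym] at hbx
  omega

lemma Axial.segment_conj {d : Grp k F} (hd : Axial d) (hconn : Conn d) (n : ℕ) (x : Grp k F) :
    Segment (d ^ n) (x⁻¹ * d ^ (n + 2 * len d) * x) := by
  induction hx : len x using Nat.strong_induction_on generalizing x with
  | _ r ih =>
  by_cases h : ∃ K, Deviates d x (d ^ (n + 2 * len d) * x) K
  · obtain ⟨K, hK⟩ := h
    obtain ⟨α, hα, hlt⟩ := hd.exists_sym_of_deviates hconn hK
    have := ih _ (hx ▸ hlt) ((sym k F α)⁻¹ * x) rfl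
    convert this using 1
    have hc := (hα.pow_right (n + 2 * len d)).eq
    rw [mul_inv_rev, inv_inv, mul_assoc x⁻¹ (sym k F α), hc]
    group
  · exact hd.segment_of_forall_not_deviates hconn n x (not_exists.1 h)

end Walls

/-- for connected, cyclically reduced `d` and `n ≥ 0`, every
conjugate of `d^{n+2|d|}` contains `dⁿ` as a segment. -/
theorem stmt17 {k : ℕ} (hk : 1 ≤ k) {F : Set (Sym2 (Fin k))}
    (d : Grp k F) (hconn : Conn d) (hcr : CycRed d) (n : ℕ)
    (c x : Grp k F) (hc : c = x⁻¹ * d ^ (n + 2 * len d) * x) :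
    Segment (d ^ n) c := by
  subst hc
  exact Axial.segment_conj hcr.between_pow hconn n x

end GraphGroupPaper
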